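/- For α ∈ [0,1), t > 0 and z ∈ ℝⁿ, one has |(−Δ)^{α/2} ∇ p_t(z)| ≲ (t² + |z|²)^{−(n+α+1)/2}, where p_t is the Poisson kernel and the gradient is taken in the z-variable. -/

import Mathlib

open MeasureTheory

/-- The Poisson kernel `p_t(z) = t/(t²+|z|²)^{(n+1)/2}` on `ℝ^{n+1}_+`. -/
noncomputable def poissonKer (n : ℕ) (t : ℝ) (z : EuclideanSpace ℝ (Fin n)) : ℝ :=
  t / (t ^ 2 + ‖z‖ ^ 2) ^ (((n : ℝ) + 1) / 2)

/-- The fractional Laplacian `(-Δ)^{α/2}` acting on functions with values in a normed space,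
via its singular integral representation. -/
noncomputable def fracLapV {n : ℕ} {F : Type*} [NormedAddCommGroup F] [NormedSpace ℝ F]
    [CompleteSpace F] (α : ℝ) (f : EuclideanSpace ℝ (Fin n) → F)
    (x : EuclideanSpace ℝ (Fin n)) : F :=
  ∫ y, (‖x - y‖ ^ (-((n : ℝ) + α))) • (f x - f y)

lemma abs_rpow_neg_sub_rpow_neg_le {m a x y : ℝ} (hm : 0 ≤ m) (ha : 0 < a) (hx : a ≤ x)
    (hy : a ≤ y) : |x ^ (-m) - y ^ (-m)| ≤ m * a ^ (-m - 1) * |x - y| := by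
  have h := Convex.norm_image_sub_le_of_norm_hasDerivWithin_le (𝕜 := ℝ) (s := Set.Ici a)
    (f := fun u : ℝ => u ^ (-m)) (f' := fun u => -m * u ^ (-m - 1)) (C := m * a ^ (-m - 1))
    (fun u hu => (Real.hasDerivAt_rpow_const
      (Or.inl (ha.trans_le hu).ne')).hasDerivWithinAt)
    (fun u hu => by
      have hu0 : 0 < u := ha.trans_le hu
      rw [norm_mul, norm_neg, Real.norm_of_nonneg hm,
        Real.norm_of_nonneg (Real.rpow_nonneg hu0.le _)]
      exact mul_le_mul_of_nonneg_left
        (Real.rpow_le_rpow_of_nonpos ha hu (by linarith)) hm)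
    (convex_Ici a) hy hx
  simpa only [Real.norm_eq_abs] using h

lemma abs_sqrt_sq_add_norm_sq_sub_le {E : Type*} [NormedAddCommGroup E] (t : ℝ) (x y : E) :
    |√(t ^ 2 + ‖x‖ ^ 2) - √(t ^ 2 + ‖y‖ ^ 2)| ≤ ‖x - y‖ := by
  have key : ∀ x y : E, √(t ^ 2 + ‖x‖ ^ 2) ≤ √(t ^ 2 + ‖y‖ ^ 2) + ‖x - y‖ := by
    intro x y
    have h1 : ‖x‖ ≤ ‖y‖ + ‖x - y‖ := by
      simpa using norm_add_le y (x - y)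
    have h2 : ‖y‖ ≤ √(t ^ 2 + ‖y‖ ^ 2) := Real.le_sqrt_of_sq_le (by nlinarith [sq_nonneg t])
    have h3 : √(t ^ 2 + ‖y‖ ^ 2) ^ 2 = t ^ 2 + ‖y‖ ^ 2 := Real.sq_sqrt (by positivity)
    apply Real.sqrt_le_left (by positivity) |>.mpr
    nlinarith [norm_nonneg x, norm_nonneg y, norm_nonneg (x - y)]
  rw [abs_le]
  have h1 := key x y
  have h2 := key y x
  rw [norm_sub_rev] at h2
  constructor <;> linarith

/-- The gradient of the Poisson kernel, as an element of the dual space. -/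
noncomputable def poissonGrad (n : ℕ) (t : ℝ) (w : EuclideanSpace ℝ (Fin n)) :
    EuclideanSpace ℝ (Fin n) →L[ℝ] ℝ :=
  (-((n + 1) * t) * √(t ^ 2 + ‖w‖ ^ 2) ^ (-((n : ℝ) + 3))) • innerSL ℝ w

lemma fderiv_poissonKer (n : ℕ) {t : ℝ} (ht : 0 < t) (w : EuclideanSpace ℝ (Fin n)) :
    fderiv ℝ (poissonKer n t) w = poissonGrad n t w := by
  have hpos : ∀ w : EuclideanSpace ℝ (Fin n), 0 < t ^ 2 + ‖w‖ ^ 2 := fun w => by positivity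
  have hp : poissonKer n t = fun w : EuclideanSpace ℝ (Fin n) =>
      t * (t ^ 2 + ‖w‖ ^ 2) ^ (-(((n : ℝ) + 1) / 2)) := by
    ext w
    rw [poissonKer, Real.rpow_neg (hpos w).le, div_eq_mul_inv]
  have h1 : HasFDerivAt (fun w : EuclideanSpace ℝ (Fin n) => t ^ 2 + ‖w‖ ^ 2)
      (2 • innerSL ℝ w) w := (hasStrictFDerivAt_norm_sq w).hasFDerivAt.const_add _
  have h2 := (h1.rpow_const (p := -(((n : ℝ) + 1) / 2)) (Or.inl (hpos w).ne')).const_mul t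
  rw [hp, h2.fderiv, poissonGrad, Real.sqrt_eq_rpow, ← Real.rpow_mul (hpos w).le, ← smul_assoc,
    ← Nat.cast_smul_eq_nsmul ℝ, smul_smul]
  congr 1
  rw [show -(((n : ℝ) + 1) / 2) - 1 = 1 / 2 * (-((n : ℝ) + 3)) by ring]
  push_cast
  simp only [smul_eq_mul]
  ring

lemma poissonKer_eq (n : ℕ) (t : ℝ) (w : EuclideanSpace ℝ (Fin n)) :
    poissonKer n t w = t * √(t ^ 2 + ‖w‖ ^ 2) ^ (-((n : ℝ) + 1)) := by
  have h : 0 ≤ t ^ 2 + ‖w‖ ^ 2 := by positivity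
  rw [poissonKer, Real.sqrt_eq_rpow, ← Real.rpow_mul h, div_eq_mul_inv, ← Real.rpow_neg h]
  ring_nf

lemma sqrt_sq_add_norm_smul_sq {E : Type*} [NormedAddCommGroup E] [NormedSpace ℝ E]
    {c : ℝ} (hc : 0 ≤ c) (t : ℝ) (w : E) :
    √((c * t) ^ 2 + ‖c • w‖ ^ 2) = c * √(t ^ 2 + ‖w‖ ^ 2) := by
  rw [norm_smul, mul_pow, mul_pow, Real.norm_eq_abs, sq_abs, ← mul_add,
    Real.sqrt_mul (by positivity), Real.sqrt_sq hc]

lemma poissonKer_smul (n : ℕ) {c : ℝ} (hc : 0 < c) (t : ℝ) (w : EuclideanSpace ℝ (Fin n)) :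
    poissonKer n (c * t) (c • w) = c ^ (-(n : ℝ)) * poissonKer n t w := by
  rw [poissonKer_eq, poissonKer_eq, sqrt_sq_add_norm_smul_sq hc.le,
    Real.mul_rpow hc.le (Real.sqrt_nonneg _),
    show -(n : ℝ) = -((n : ℝ) + 1) + 1 by ring, Real.rpow_add_one hc.ne']
  ring_nf

lemma poissonGrad_smul (n : ℕ) {c : ℝ} (hc : 0 < c) (t : ℝ) (w : EuclideanSpace ℝ (Fin n)) :
    poissonGrad n (c * t) (c • w) = c ^ (-((n : ℝ) + 1)) • poissonGrad n t w := by
  rw [poissonGrad, poissonGrad, sqrt_sq_add_norm_smul_sq hc.le,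
    Real.mul_rpow hc.le (Real.sqrt_nonneg _), map_smul, smul_smul, smul_smul,
    show -((n : ℝ) + 1) = -((n : ℝ) + 3) + 1 + 1 by ring, Real.rpow_add_one hc.ne',
    Real.rpow_add_one hc.ne']
  congr 1
  ring

lemma integrable_poissonKer_one (n : ℕ) : Integrable (poissonKer n 1) := by
  have h := integrable_rpow_neg_one_add_norm_sq (E := EuclideanSpace ℝ (Fin n)) (μ := volume)
    (r := (n : ℝ) + 1) (by simp)
  refine h.congr (Filter.Eventually.of_forall fun w => ?_)
  have h0 : 0 ≤ 1 + ‖w‖ ^ 2 := by positivity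
  simp only [poissonKer, one_pow, neg_div, Real.rpow_neg h0, one_div]

lemma poissonKer_eq_comp_smul (n : ℕ) {t : ℝ} (ht : 0 < t) :
    poissonKer n t = fun w => t ^ (-(n : ℝ)) * poissonKer n 1 (t⁻¹ • w) := by
  ext w
  rw [← poissonKer_smul n ht, mul_one, smul_inv_smul₀ ht.ne']

lemma integrable_poissonKer (n : ℕ) {t : ℝ} (ht : 0 < t) : Integrable (poissonKer n t) := by
  rw [poissonKer_eq_comp_smul n ht]
  exact ((integrable_poissonKer_one n).comp_smul (inv_ne_zero ht.ne')).const_mul _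

lemma integral_poissonKer (n : ℕ) {t : ℝ} (ht : 0 < t) :
    ∫ w, poissonKer n t w = ∫ w, poissonKer n 1 w := by
  rw [poissonKer_eq_comp_smul n ht, integral_const_mul, Measure.integral_comp_smul,
    finrank_euclideanSpace_fin, smul_eq_mul, ← mul_assoc, Real.rpow_neg ht.le, Real.rpow_natCast,
    inv_pow, inv_inv, abs_of_pos (pow_pos ht n), inv_mul_cancel₀ (pow_pos ht n).ne', one_mul]

lemma fracLapV_poissonGrad_smul (n : ℕ) (α : ℝ) {c : ℝ} (hc : 0 < c) (t : ℝ)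
    (z : EuclideanSpace ℝ (Fin n)) :
    fracLapV α (poissonGrad n (c * t)) (c • z) =
      c ^ (-((n : ℝ) + α + 1)) • fracLapV α (poissonGrad n t) z := by
  have h := Measure.integral_comp_smul (volume : Measure (EuclideanSpace ℝ (Fin n)))
    (fun y => (‖c • z - y‖ ^ (-((n : ℝ) + α))) •
      (poissonGrad n (c * t) (c • z) - poissonGrad n (c * t) y)) c
  have h2 : ∀ y, (‖c • z - c • y‖ ^ (-((n : ℝ) + α))) •
      (poissonGrad n (c * t) (c • z) - poissonGrad n (c * t) (c • y)) =
      (c ^ (-((n : ℝ) + α)) * c ^ (-((n : ℝ) + 1))) • ((‖z - y‖ ^ (-((n : ℝ) + α))) •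
        (poissonGrad n t z - poissonGrad n t y)) := by
    intro y
    have h3 := smul_sub (c ^ (-((n : ℝ) + 1))) (poissonGrad n t z) (poissonGrad n t y)
    rw [poissonGrad_smul n hc, poissonGrad_smul n hc, ← h3, ← smul_sub, norm_smul,
      Real.norm_of_nonneg hc.le, Real.mul_rpow hc.le (norm_nonneg _), smul_smul, smul_smul]
    congr 1
    ring
  simp only [h2] at h
  rw [integral_smul, finrank_euclideanSpace_fin, abs_of_pos (inv_pos.2 (pow_pos hc n))] at h
  have h3 := congrArg (fun v => c ^ n • v) h
  simp only [smul_inv_smul₀ (pow_pos hc n).ne'] at h3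
  rw [fracLapV, ← h3, smul_smul, fracLapV, ← Real.rpow_natCast, ← Real.rpow_add hc,
    ← Real.rpow_add hc]
  congr 2
  ring

lemma continuous_poissonGrad (n : ℕ) {t : ℝ} (ht : 0 < t) : Continuous (poissonGrad n t) := by
  have hs : Continuous fun w : EuclideanSpace ℝ (Fin n) =>
      √(t ^ 2 + ‖w‖ ^ 2) ^ (-((n : ℝ) + 3)) := by
    refine Continuous.rpow_const (by fun_prop) fun w => Or.inl ?_
    have : 0 < t ^ 2 + ‖w‖ ^ 2 := by positivity
    exact (Real.sqrt_pos.2 this).ne'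
  exact (continuous_const.mul hs).smul (innerSL ℝ).continuous

lemma poissonGrad_neg (n : ℕ) (t : ℝ) (w : EuclideanSpace ℝ (Fin n)) :
    poissonGrad n t (-w) = -poissonGrad n t w := by
  rw [poissonGrad, poissonGrad, norm_neg, map_neg, smul_neg]

lemma norm_poissonGrad (n : ℕ) {t : ℝ} (ht : 0 ≤ t) (w : EuclideanSpace ℝ (Fin n)) :
    ‖poissonGrad n t w‖ = (n + 1) * t * √(t ^ 2 + ‖w‖ ^ 2) ^ (-((n : ℝ) + 3)) * ‖w‖ := by
  rw [poissonGrad, norm_smul, innerSL_apply_norm, norm_mul, norm_neg,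
    Real.norm_of_nonneg (by positivity), Real.norm_of_nonneg (by positivity)]

lemma norm_poissonGrad_mul_norm_le (n : ℕ) {t : ℝ} (ht : 0 < t) (w : EuclideanSpace ℝ (Fin n)) :
    ‖poissonGrad n t w‖ * ‖w‖ ≤ (n + 1) * poissonKer n t w := by
  have h0 : 0 < t ^ 2 + ‖w‖ ^ 2 := by positivity
  have hs : 0 < √(t ^ 2 + ‖w‖ ^ 2) := Real.sqrt_pos.2 h0
  rw [norm_poissonGrad n ht.le, poissonKer_eq,
    show -((n : ℝ) + 1) = -((n : ℝ) + 3) + 1 + 1 by ring, Real.rpow_add_one hs.ne',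
    Real.rpow_add_one hs.ne']
  have h1 : ‖w‖ * ‖w‖ ≤ √(t ^ 2 + ‖w‖ ^ 2) * √(t ^ 2 + ‖w‖ ^ 2) := by
    rw [Real.mul_self_sqrt h0.le]
    nlinarith [sq_nonneg t]
  have h2 : 0 ≤ (n + 1) * t * √(t ^ 2 + ‖w‖ ^ 2) ^ (-((n : ℝ) + 3)) := by positivity
  nlinarith [mul_le_mul_of_nonneg_left h1 h2]

lemma norm_poissonGrad_le (n : ℕ) {t : ℝ} (ht : 0 < t) (w : EuclideanSpace ℝ (Fin n)) :
    ‖poissonGrad n t w‖ ≤ (n + 1) / t * poissonKer n t w := by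
  have h0 : 0 < t ^ 2 + ‖w‖ ^ 2 := by positivity
  have hs : 0 < √(t ^ 2 + ‖w‖ ^ 2) := Real.sqrt_pos.2 h0
  rw [norm_poissonGrad n ht.le, poissonKer_eq,
    show -((n : ℝ) + 1) = -((n : ℝ) + 3) + 1 + 1 by ring, Real.rpow_add_one hs.ne',
    Real.rpow_add_one hs.ne']
  have h1 : t * ‖w‖ ≤ √(t ^ 2 + ‖w‖ ^ 2) * √(t ^ 2 + ‖w‖ ^ 2) := by
    rw [Real.mul_self_sqrt h0.le]
    nlinarith [sq_nonneg (t - ‖w‖), sq_nonneg (t + ‖w‖)]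
  have h2 : 0 ≤ (n + 1) * √(t ^ 2 + ‖w‖ ^ 2) ^ (-((n : ℝ) + 3)) := by positivity
  have h3 := mul_le_mul_of_nonneg_left h1 h2
  rw [← mul_assoc, div_mul_cancel₀ _ ht.ne']
  nlinarith

lemma integrable_poissonGrad (n : ℕ) {t : ℝ} (ht : 0 < t) : Integrable (poissonGrad n t) :=
  ((integrable_poissonKer n ht).const_mul ((n + 1) / t)).mono'
    (continuous_poissonGrad n ht).aestronglyMeasurable
    (Filter.Eventually.of_forall fun w => norm_poissonGrad_le n ht w)

lemma norm_poissonGrad_sub_le (n : ℕ) {t : ℝ} (ht : 0 < t) {z y : EuclideanSpace ℝ (Fin n)}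
    (hz : t ^ 2 + ‖z‖ ^ 2 = 1) (hy : ‖z - y‖ ≤ 1 / 2) :
    ‖poissonGrad n t z - poissonGrad n t y‖ ≤
      (n + 1) * (1 + (n + 3) * (1 / 2) ^ (-((n : ℝ) + 3) - 1) * (3 / 2)) * ‖z - y‖ := by
  have ht1 : t ≤ 1 := by nlinarith [sq_nonneg ‖z‖]
  have hz1 : ‖z‖ ≤ 1 := by nlinarith [sq_nonneg t]
  have hsz : √(t ^ 2 + ‖z‖ ^ 2) = 1 := by rw [hz, Real.sqrt_one]
  have hs := abs_sqrt_sq_add_norm_sq_sub_le t z y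
  rw [hsz] at hs
  have hsy : 1 / 2 ≤ √(t ^ 2 + ‖y‖ ^ 2) := by linarith [(abs_le.1 hs).2]
  have hφ := abs_rpow_neg_sub_rpow_neg_le (m := (n : ℝ) + 3) (by positivity)
    (by norm_num : (0 : ℝ) < 1 / 2) (by norm_num : (1 / 2 : ℝ) ≤ 1) hsy
  have hy1 : ‖y‖ ≤ 3 / 2 := by
    have := norm_sub_le z (z - y)
    rw [sub_sub_cancel] at this
    linarith
  rw [Real.one_rpow] at hφ
  set φ := √(t ^ 2 + ‖y‖ ^ 2) ^ (-((n : ℝ) + 3)) with hφ_def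
  have heq : poissonGrad n t z - poissonGrad n t y =
      innerSL ℝ ((-((n + 1) * t)) • ((z - y) + (1 - φ) • y)) := by
    rw [poissonGrad, poissonGrad, hsz, Real.one_rpow, ← hφ_def, ← map_smul, ← map_smul, ← map_sub]
    congr 1
    module
  rw [heq, innerSL_apply_norm, norm_smul, norm_neg, Real.norm_of_nonneg (by positivity)]
  have hL : 0 ≤ ((n : ℝ) + 3) * (1 / 2) ^ (-((n : ℝ) + 3) - 1) := by positivity
  have h1 : ‖(z - y) + (1 - φ) • y‖ ≤
      (1 + (n + 3) * (1 / 2) ^ (-((n : ℝ) + 3) - 1) * (3 / 2)) * ‖z - y‖ := by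
    refine (norm_add_le _ _).trans ?_
    rw [norm_smul, Real.norm_eq_abs]
    have h2 : |1 - φ| * ‖y‖ ≤
        ((n + 3) * (1 / 2) ^ (-((n : ℝ) + 3) - 1) * ‖z - y‖) * (3 / 2) :=
      mul_le_mul (hφ.trans (mul_le_mul_of_nonneg_left hs hL)) hy1 (norm_nonneg _) (by positivity)
    linarith
  have h3 : ((n : ℝ) + 1) * t ≤ n + 1 := by nlinarith [Nat.cast_nonneg (α := ℝ) n]
  rw [mul_assoc (_ : ℝ) (1 + _)]
  exact mul_le_mul h3 h1 (norm_nonneg _) (by positivity)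

/-- The Riesz-type kernel `|w|^{-m}` truncated at height `2^m`. -/
noncomputable def truncKer {n : ℕ} (m : ℝ) (w : EuclideanSpace ℝ (Fin n)) : ℝ :=
  max ‖w‖ (1 / 2) ^ (-m)

section truncKer

variable {n : ℕ} {m : ℝ}

lemma truncKer_nonneg (w : EuclideanSpace ℝ (Fin n)) : 0 ≤ truncKer m w := by
  unfold truncKer
  positivity

lemma continuous_truncKer : Continuous (truncKer (n := n) m) := by
  refine Continuous.rpow_const (by fun_prop) fun w => Or.inl ?_
  positivity

lemma truncKer_le (hm : 0 ≤ m) (w : EuclideanSpace ℝ (Fin n)) :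
    truncKer m w ≤ (1 / 2) ^ (-m) :=
  Real.rpow_le_rpow_of_nonpos (by norm_num) (le_max_right _ _) (by linarith)

lemma abs_truncKer_sub_le (hm : 0 ≤ m) (v w : EuclideanSpace ℝ (Fin n)) :
    |truncKer m v - truncKer m w| ≤ m * (1 / 2) ^ (-m - 1) * |‖v‖ - ‖w‖| := by
  refine (abs_rpow_neg_sub_rpow_neg_le hm (by norm_num : (0 : ℝ) < 1 / 2) (le_max_right _ _)
    (le_max_right _ _)).trans (mul_le_mul_of_nonneg_left ?_ (by positivity))
  exact abs_max_sub_max_le_abs _ _ _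

lemma abs_rpow_norm_sub_truncKer_le (hm : 0 ≤ m) {w : EuclideanSpace ℝ (Fin n)} (hw : w ≠ 0) :
    |‖w‖ ^ (-m) - truncKer m w| ≤ ‖w‖ ^ (-m) := by
  have h : truncKer m w ≤ ‖w‖ ^ (-m) :=
    Real.rpow_le_rpow_of_nonpos (norm_pos_iff.2 hw) (le_max_left _ _) (by linarith)
  rw [abs_of_nonneg (sub_nonneg.2 h)]
  linarith [truncKer_nonneg (m := m) w]

lemma truncKer_eq {w : EuclideanSpace ℝ (Fin n)} (hw : 1 / 2 ≤ ‖w‖) :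
    truncKer m w = ‖w‖ ^ (-m) := by
  rw [truncKer, max_eq_left hw]

lemma integrable_truncKer_smul_poissonGrad (hm : 0 ≤ m) {t : ℝ} (ht : 0 < t)
    {g : EuclideanSpace ℝ (Fin n) → EuclideanSpace ℝ (Fin n)} (hg : Continuous g) :
    Integrable fun y => truncKer m (g y) • poissonGrad n t y := by
  refine (integrable_poissonGrad n ht).bdd_smul ((1 / 2) ^ (-m))
    (continuous_truncKer.comp hg).aestronglyMeasurable (Filter.Eventually.of_forall fun y => ?_)
  rw [Function.comp, Real.norm_of_nonneg (truncKer_nonneg _)]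
  exact truncKer_le hm _

lemma norm_integral_truncKer_smul_poissonGrad_le (hm : 0 ≤ m) {t : ℝ} (ht : 0 < t)
    (z : EuclideanSpace ℝ (Fin n)) :
    ‖∫ y, truncKer m (z - y) • poissonGrad n t y‖ ≤
      m * (1 / 2) ^ (-m - 1) * (n + 1) * ∫ y, poissonKer n 1 y := by
  have hneg : ∫ y, truncKer m (z + y) • poissonGrad n t y =
      -∫ y, truncKer m (z - y) • poissonGrad n t y := by
    rw [← integral_neg_eq_self (fun y => truncKer m (z + y) • poissonGrad n t y) volume,
      ← integral_neg]
    refine integral_congr_ae (Filter.Eventually.of_forall fun y => ?_)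
    change truncKer m (z + -y) • poissonGrad n t (-y) = -(truncKer m (z - y) • poissonGrad n t y)
    rw [poissonGrad_neg, sub_eq_add_neg]
    exact smul_neg _ _
  have hsub : ∫ y, (truncKer m (z - y) - truncKer m (z + y)) • poissonGrad n t y =
      (2 : ℝ) • ∫ y, truncKer m (z - y) • poissonGrad n t y := by
    have h := integral_sub
      (integrable_truncKer_smul_poissonGrad hm ht (g := fun y => z - y) (by fun_prop))
      (integrable_truncKer_smul_poissonGrad hm ht (g := fun y => z + y) (by fun_prop))
    rw [hneg, sub_neg_eq_add, ← two_smul ℝ] at h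
    rw [← h]
    refine integral_congr_ae (Filter.Eventually.of_forall fun y => ?_)
    dsimp only
    module
  have hle : ‖∫ y, (truncKer m (z - y) - truncKer m (z + y)) • poissonGrad n t y‖ ≤
      ∫ y, 2 * (m * (1 / 2) ^ (-m - 1)) * (n + 1) * poissonKer n t y := by
    refine norm_integral_le_of_norm_le ((integrable_poissonKer n ht).const_mul _)
      (Filter.Eventually.of_forall fun y => ?_)
    rw [norm_smul, Real.norm_eq_abs]
    have h1 : |‖z - y‖ - ‖z + y‖| ≤ 2 * ‖y‖ := by
      refine (abs_norm_sub_norm_le _ _).trans ?_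
      rw [show z - y - (z + y) = (-2 : ℝ) • y by module, norm_smul]
      norm_num
    have h2 := (abs_truncKer_sub_le hm (z - y) (z + y)).trans
      (mul_le_mul_of_nonneg_left h1 (by positivity))
    calc _ ≤ m * (1 / 2) ^ (-m - 1) * (2 * ‖y‖) * ‖poissonGrad n t y‖ := by gcongr
      _ = 2 * (m * (1 / 2) ^ (-m - 1)) * (‖poissonGrad n t y‖ * ‖y‖) := by ring
      _ ≤ 2 * (m * (1 / 2) ^ (-m - 1)) * ((n + 1) * poissonKer n t y) := by
        exact mul_le_mul_of_nonneg_left (norm_poissonGrad_mul_norm_le n ht y) (by positivity)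
      _ = _ := by ring
  rw [hsub, norm_smul, Real.norm_of_nonneg zero_le_two, integral_const_mul,
    integral_poissonKer n ht] at hle
  linarith

end truncKer

lemma integrable_indicator_ball_rpow_norm {n : ℕ} (hn : n ≠ 0) {β : ℝ} (hβ : β < n) :
    Integrable ((Metric.ball (0 : EuclideanSpace ℝ (Fin n)) (1 / 2)).indicator
      fun w => ‖w‖ ^ (-β)) := by
  rw [integrable_indicator_iff Metric.isOpen_ball.measurableSet]
  refine integrableOn_ball_of_norm_le_rpow (C := 1) (α := β) ?_ (by simpa using hβ) ?_ ?_
  · simpa using Nat.one_le_iff_ne_zero.2 hn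
  · refine Filter.Eventually.of_forall fun w => ?_
    rw [one_mul, Real.norm_of_nonneg (by positivity)]
  · exact (measurable_norm.pow_const _).aestronglyMeasurable

lemma exists_norm_fracLapV_poissonGrad_le {n : ℕ} (hn : n ≠ 0) {α : ℝ} (h0 : 0 ≤ α)
    (h1 : α < 1) : ∃ C : ℝ, ∀ t : ℝ, 0 < t → ∀ z : EuclideanSpace ℝ (Fin n),
      t ^ 2 + ‖z‖ ^ 2 = 1 → ‖fracLapV α (poissonGrad n t) z‖ ≤ C := by
  set m : ℝ := n + α with hm_def
  have hm : 0 ≤ m := by positivity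
  set L : ℝ := (n + 1) * (1 + (n + 3) * (1 / 2) ^ (-((n : ℝ) + 3) - 1) * (3 / 2)) with hL_def
  have hL : 0 ≤ L := by positivity
  set B : EuclideanSpace ℝ (Fin n) → ℝ := (Metric.ball 0 (1 / 2)).indicator
    fun w => ‖w‖ ^ (-(m - 1)) with hB_def
  have hB : Integrable B := integrable_indicator_ball_rpow_norm hn (by linarith)
  have hB0 : ∀ w, 0 ≤ B w := Set.indicator_nonneg fun w _ => by positivity
  set A : ℝ := ∫ w : EuclideanSpace ℝ (Fin n), truncKer m w with hA_def
  have hA : 0 ≤ A := integral_nonneg truncKer_nonneg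
  set D : ℝ := m * (1 / 2) ^ (-m - 1) * (n + 1) *
    ∫ y : EuclideanSpace ℝ (Fin n), poissonKer n 1 y with hD_def
  have hI : 0 ≤ ∫ y : EuclideanSpace ℝ (Fin n), poissonKer n 1 y := integral_nonneg fun y => by
    change 0 ≤ poissonKer n 1 y
    unfold poissonKer
    positivity
  have hD : 0 ≤ D := by positivity
  refine ⟨L * (∫ w, B w) + A * (n + 1) + D, fun t ht z hz => ?_⟩
  set f := poissonGrad n t with hf_def
  by_cases hF : Integrable fun y => ‖z - y‖ ^ (-m) • (f z - f y)
  swap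
  · rw [fracLapV, integral_undef hF, norm_zero]
    have hBI : 0 ≤ ∫ w, B w := integral_nonneg hB0
    positivity
  have hbound : ∀ y, ‖(‖z - y‖ ^ (-m) - truncKer m (z - y)) • (f z - f y)‖ ≤
      L * B (z - y) := by
    intro y
    rcases eq_or_ne y z with rfl | hyz
    · rw [sub_self (f y), smul_zero, norm_zero]
      exact mul_nonneg hL (hB0 _)
    have hw : z - y ≠ 0 := sub_ne_zero.2 hyz.symm
    rcases lt_or_ge ‖z - y‖ (1 / 2) with hlt | hge
    · rw [hB_def, Set.indicator_of_mem (by simpa using hlt), norm_smul, Real.norm_eq_abs,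
        show -(m - 1) = -m + 1 by ring, Real.rpow_add_one (norm_ne_zero_iff.2 hw)]
      calc _ ≤ ‖z - y‖ ^ (-m) * (L * ‖z - y‖) :=
            mul_le_mul (abs_rpow_norm_sub_truncKer_le hm hw)
              (norm_poissonGrad_sub_le n ht hz hlt.le) (norm_nonneg _) (by positivity)
        _ = _ := by ring
    · rw [truncKer_eq hge, sub_self, zero_smul, norm_zero]
      exact mul_nonneg hL (hB0 _)
  have hbi : Integrable fun y => L * B (z - y) := (hB.comp_sub_left z).const_mul L
  have hfc : Continuous f := continuous_poissonGrad n ht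
  have hT : Continuous fun y => truncKer m (z - y) := continuous_truncKer.comp (by fun_prop)
  have hG1 : Integrable fun y => (‖z - y‖ ^ (-m) - truncKer m (z - y)) • (f z - f y) := by
    refine hbi.mono' (AEStronglyMeasurable.fun_smul ?_ ?_) (Filter.Eventually.of_forall hbound)
    · exact (((measurable_const.sub measurable_id).norm.pow_const _).sub
        hT.measurable).aestronglyMeasurable
    · exact (continuous_const.sub hfc).aestronglyMeasurable
  have hG3 : Integrable fun y => truncKer m (z - y) • f y :=
    integrable_truncKer_smul_poissonGrad hm ht (by fun_prop)
  have hG2 : Integrable fun y => truncKer m (z - y) • f z := by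
    refine ((hF.sub hG1).add hG3).congr (Filter.Eventually.of_forall fun y => ?_)
    simp only [Pi.add_apply, Pi.sub_apply]
    module
  have hsplit : fracLapV α f z =
      (∫ y, (‖z - y‖ ^ (-m) - truncKer m (z - y)) • (f z - f y)) +
        (∫ y, truncKer m (z - y) • f z) - ∫ y, truncKer m (z - y) • f y := by
    rw [fracLapV, ← integral_add' hG1 hG2, ← integral_sub (hG1.add hG2) hG3]
    refine integral_congr_ae (Filter.Eventually.of_forall fun y => ?_)
    simp only [Pi.add_apply]
    module
  have hI1 : ‖∫ y, (‖z - y‖ ^ (-m) - truncKer m (z - y)) • (f z - f y)‖ ≤ L * ∫ w, B w := by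
    refine (norm_integral_le_of_norm_le hbi (Filter.Eventually.of_forall hbound)).trans_eq ?_
    rw [integral_const_mul, integral_sub_left_eq_self]
  have hfz : ‖f z‖ ≤ n + 1 := by
    have ht1 : t ≤ 1 := by nlinarith [sq_nonneg ‖z‖]
    have hz1 : ‖z‖ ≤ 1 := by nlinarith [sq_nonneg t]
    rw [hf_def, norm_poissonGrad n ht.le, hz, Real.sqrt_one, Real.one_rpow, mul_one, mul_assoc]
    exact mul_le_of_le_one_right (by positivity) (mul_le_one₀ ht1 (norm_nonneg _) hz1)
  have hI2 : ‖∫ y, truncKer m (z - y) • f z‖ ≤ A * (n + 1) := by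
    rw [integral_smul_const, integral_sub_left_eq_self (truncKer m) volume z, norm_smul,
      Real.norm_of_nonneg hA]
    gcongr
  have hI3 : ‖∫ y, truncKer m (z - y) • f y‖ ≤ D :=
    norm_integral_truncKer_smul_poissonGrad_le hm ht z
  rw [hsplit]
  exact norm_sub_le_of_le (norm_add_le_of_le hI1 hI2) hI3

/-- For `α ∈ [0,1)`, `t > 0` and `z ∈ ℝⁿ`:
`|(−Δ)^{α/2} ∇p_t(z)| ≲ (t² + |z|²)^{−(n+α+1)/2}`, the gradient being taken in `z`. -/
theorem fracLap_grad_poisson_bound (n : ℕ) (α : ℝ) (hα : α ∈ Set.Ico (0:ℝ) 1) :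
    ∃ C : ℝ, 0 < C ∧
      ∀ t : ℝ, 0 < t → ∀ z : EuclideanSpace ℝ (Fin n),
        ‖fracLapV α (fun w => fderiv ℝ (poissonKer n t) w) z‖ ≤
          C * (t ^ 2 + ‖z‖ ^ 2) ^ (-((n : ℝ) + α + 1) / 2) := by
  have hfd : ∀ t : ℝ, 0 < t →
      (fun w => fderiv ℝ (poissonKer n t) w) = poissonGrad n t :=
    fun t ht => funext fun w => fderiv_poissonKer n ht w
  rcases eq_or_ne n 0 with rfl | hn
  · refine ⟨1, one_pos, fun t ht z => ?_⟩
    have h : ∀ y, poissonGrad 0 t z - poissonGrad 0 t y = 0 := fun y => by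
      rw [Subsingleton.elim y z, sub_self]
    simp only [hfd t ht, fracLapV, h, smul_zero, integral_zero, norm_zero]
    positivity
  obtain ⟨C, hC⟩ := exists_norm_fracLapV_poissonGrad_le hn hα.1 hα.2
  refine ⟨max C 1, by positivity, fun t ht z => ?_⟩
  have hpos : 0 < t ^ 2 + ‖z‖ ^ 2 := by positivity
  set c := √(t ^ 2 + ‖z‖ ^ 2) with hc_def
  have hc : 0 < c := Real.sqrt_pos.2 hpos
  have hnorm : (c⁻¹ * t) ^ 2 + ‖c⁻¹ • z‖ ^ 2 = 1 := by
    have h := sqrt_sq_add_norm_smul_sq (inv_pos.2 hc).le t z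
    rwa [← hc_def, inv_mul_cancel₀ hc.ne', Real.sqrt_eq_one] at h
  have hscale := fracLapV_poissonGrad_smul n α hc (c⁻¹ * t) (c⁻¹ • z)
  rw [mul_inv_cancel_left₀ hc.ne', smul_inv_smul₀ hc.ne'] at hscale
  have hexp : (t ^ 2 + ‖z‖ ^ 2) ^ (-((n : ℝ) + α + 1) / 2) = c ^ (-((n : ℝ) + α + 1)) := by
    rw [hc_def, Real.sqrt_eq_rpow, ← Real.rpow_mul hpos.le]
    ring_nf
  rw [hfd t ht, hscale, hexp, norm_smul, Real.norm_of_nonneg (by positivity), mul_comm]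
  gcongr
  exact (hC _ (by positivity) _ hnorm).trans (le_max_left _ _)
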